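/- arXiv:1703.01323 — 2 statements merged into one kernel-verified Lean document; each statement's English description precedes it below -/
import Mathlib

section
/- Let N be a positive integer, let n : Fin N → ℤ be integer exponents, let M_inf : Matrix (Fin N) (Fin N) ℝ be a fixed matrix, and let M : ℝ → Matrix (Fin N) (Fin N) ℝ be a family of matrices such that for every column index j and every row index i, the function c ↦ M c i j − c^(n j) * (M_inf i j) is O(c^(n j − 1)) as c → ∞ (along the filter atTop on ℝ, with c^k denoting the integer power zpow for c > 0). Then the function c ↦ det (M c) − c^(n 0 + ⋯ + n (N−1)) * det M_inf is O(c^(n 0 + ⋯ + n (N−1) − 1)) as c → ∞. -/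
open Filter Asymptotics

theorem isBigO_zpow_sub_one_zpow (k : ℤ) :
    (fun c : ℝ => c ^ (k - 1)) =O[atTop] fun c : ℝ => c ^ k := by
  refine IsBigO.of_bound 1 ?_
  filter_upwards [eventually_ge_atTop (1 : ℝ)] with c hc
  have hc0 : 0 < c := by linarith
  rw [Real.norm_of_nonneg (zpow_pos hc0 _).le, Real.norm_of_nonneg (zpow_pos hc0 _).le, one_mul]
  exact zpow_le_zpow_right₀ hc (by omega)

theorem isBigO_prod_sub_zpow_mul_prod {ι : Type*} (s : Finset ι) (n : ι → ℤ)
    (a : ι → ℝ) (f : ι → ℝ → ℝ)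
    (h : ∀ j ∈ s, (fun c : ℝ => f j c - c ^ (n j) * a j) =O[atTop] fun c : ℝ => c ^ (n j - 1)) :
    (fun c : ℝ => ∏ j ∈ s, f j c - c ^ (∑ j ∈ s, n j) * ∏ j ∈ s, a j)
      =O[atTop] fun c : ℝ => c ^ ((∑ j ∈ s, n j) - 1) := by
  classical
  induction s using Finset.induction_on with
  | empty => simpa using isBigO_zero _ _
  | insert j s hj ih =>
    have hs := ih fun i hi => h i (Finset.mem_insert_of_mem hi)
    have hf := h j (Finset.mem_insert_self j s)
    have hprod : (fun c : ℝ => ∏ i ∈ s, f i c) =O[atTop] fun c : ℝ => c ^ (∑ i ∈ s, n i) := by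
      have hlead : (fun c : ℝ => c ^ (∑ i ∈ s, n i) * ∏ i ∈ s, a i)
          =O[atTop] fun c : ℝ => c ^ (∑ i ∈ s, n i) := by
        simpa only [mul_comm] using
          (isBigO_refl (fun c : ℝ => c ^ (∑ i ∈ s, n i)) atTop).const_mul_left (∏ i ∈ s, a i)
      simpa using (hs.trans (isBigO_zpow_sub_one_zpow _)).add hlead
    have hcoeff : (fun c : ℝ => a j * c ^ n j) =O[atTop] fun c : ℝ => c ^ n j :=
      (isBigO_refl _ _).const_mul_left _
    have hne := eventually_ne_atTop (0 : ℝ)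
    have h₁ := (hf.mul hprod).congr' EventuallyEq.rfl
      (g₂ := fun c : ℝ => c ^ (n j + ∑ i ∈ s, n i - 1)) <| by
        filter_upwards [hne] with c hc
        rw [← zpow_add₀ hc]
        congr 1
        ring
    have h₂ := (hcoeff.mul hs).congr' EventuallyEq.rfl
      (g₂ := fun c : ℝ => c ^ (n j + ∑ i ∈ s, n i - 1)) <| by
        filter_upwards [hne] with c hc
        rw [← zpow_add₀ hc]
        congr 1
        ring
    simp only [Finset.prod_insert hj, Finset.sum_insert hj]
    refine (h₁.add h₂).congr' ?_ EventuallyEq.rfl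
    filter_upwards [hne] with c hc
    rw [zpow_add₀ hc]
    ring

/-- Asymptotic expansion of the determinant: if each column `j` of the matrix family
`M c` satisfies `M c i j = c ^ (n j) * M_inf i j + O(c ^ (n j - 1))` as `c → ∞`, then
`det (M c) = c ^ (∑ j, n j) * det M_inf + O(c ^ (∑ j, n j - 1))` as `c → ∞`. -/
theorem det_asymptotic
    (N : ℕ) (hN : 0 < N) (n : Fin N → ℤ)
    (M_inf : Matrix (Fin N) (Fin N) ℝ)
    (M : ℝ → Matrix (Fin N) (Fin N) ℝ)
    (h : ∀ j i : Fin N,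
      (fun c : ℝ => M c i j - c ^ (n j) * M_inf i j)
        =O[atTop] fun c : ℝ => c ^ (n j - 1)) :
    (fun c : ℝ => (M c).det - c ^ (∑ j, n j) * M_inf.det)
      =O[atTop] fun c : ℝ => c ^ ((∑ j, n j) - 1) := by
  simp only [Matrix.det_apply', Finset.mul_sum, ← Finset.sum_sub_distrib]
  refine IsBigO.fun_sum fun σ _ => ?_
  have hσ := isBigO_prod_sub_zpow_mul_prod Finset.univ n (fun j => M_inf (σ j) j)
    (fun j c => M c (σ j) j) fun j _ => h j (σ j)
  refine (hσ.const_mul_left ((Equiv.Perm.sign σ : ℤ) : ℝ)).congr_left fun c => ?_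
  ring
end

section
/- Let n ≥ 2 be a natural number, m := 2n, λ > 0 a real number, and p ∈ ℝ. Then there exists c₀ ∈ ℝ such that for every c ≥ c₀ the following holds: there exist A > 0, B > 0 and a function f : ℝ → ℝ, twice continuously differentiable on an open interval containing [λ, 1+λ], such that (i) x²·f''(x) − m·x·f'(x) + m·f(x) = −A·(p·(x−λ)+c)^(n−1) + B·x²·(p·(x−λ)+c)^(n−2) for all x ∈ [λ, 1+λ]; (ii) f(λ) = 0, f(1+λ) = 0, f'(λ) = 2·c^(n−1), f'(1+λ) = −2·(p+c)^(n−1); (iii) f(x) > 0 for all x with λ < x < 1+λ. Moreover the solution is unique: if (A₁, B₁, f₁) and (A₂, B₂, f₂) are two triples with A₁, A₂, B₁, B₂ ∈ ℝ and f₁, f₂ twice differentiable satisfying (i) and (ii), then A₁ = A₂, B₁ = B₂, and f₁ = f₂ on [λ, 1+λ]. -/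
open Set Filter Topology intervalIntegral

/-- A strict trapezoid inequality for powers. -/
theorem trapezoid_pow_lt {x y : ℝ} (hy : 0 < y) (hxy : y < x) {j : ℕ} (hj : 0 < j) :
    2 * (x * y * (x ^ j - y ^ j)) < j * ((x - y) * (x ^ (j + 1) + y ^ (j + 1))) := by
  have hx : 0 < x := hy.trans hxy
  have hpair : ∀ i ∈ Finset.range j,
      x * y * (x ^ i * y ^ (j - 1 - i) + y ^ i * x ^ (j - 1 - i)) <
        x ^ (j + 1) + y ^ (j + 1) := by
    intro i hi
    obtain ⟨l, rfl⟩ : ∃ l, j = i + l + 1 :=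
      ⟨j - 1 - i, by have := Finset.mem_range.1 hi; omega⟩
    have h1 : y ^ (i + 1) < x ^ (i + 1) := pow_lt_pow_left₀ hxy hy.le (by omega)
    have h2 : y ^ (l + 1) < x ^ (l + 1) := pow_lt_pow_left₀ hxy hy.le (by omega)
    have h3 : i + l + 1 - 1 - i = l := by omega
    rw [h3]
    have := mul_pos (sub_pos.2 h1) (sub_pos.2 h2)
    ring_nf at this ⊢
    linarith
  have hsum := Finset.sum_lt_sum_of_nonempty (Finset.nonempty_range_iff.2 hj.ne') hpair
  rw [Finset.sum_const, Finset.card_range, nsmul_eq_mul, ← Finset.mul_sum,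
    Finset.sum_add_distrib] at hsum
  have h1 := geom_sum₂_mul x y j
  have h2 := geom_sum₂_mul y x j
  have := mul_lt_mul_of_pos_right hsum (sub_pos.2 hxy)
  calc 2 * (x * y * (x ^ j - y ^ j))
      = x * y * ((x ^ j - y ^ j) - (y ^ j - x ^ j)) := by ring
    _ = _ := by rw [← h1, ← h2]; ring
    _ < _ := this
    _ = _ := by ring

/-- The integral over `[a, 1 + a]` of `t⁻ⁱ (η (t - a) + 1)ᵏ`, the weight being extended
continuously to the left of `a`. -/
noncomputable def weightedMoment (a : ℝ) (i k : ℕ) (η : ℝ) : ℝ :=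
  ∫ t in a..(1 + a), ((max t a)⁻¹) ^ i * (η * (t - a) + 1) ^ k

theorem continuous_inv_max {a : ℝ} (ha : 0 < a) : Continuous fun t : ℝ => (max t a)⁻¹ :=
  (continuous_id.max continuous_const).inv₀ fun _ => (lt_max_of_lt_right ha).ne'

theorem continuous_weightedMoment {a : ℝ} (ha : 0 < a) (i k : ℕ) :
    Continuous (weightedMoment a i k) := by
  have h := continuous_inv_max ha
  apply continuous_parametric_intervalIntegral_of_continuous'
  have h' : Continuous fun q : ℝ × ℝ => (max q.2 a)⁻¹ := h.comp continuous_snd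
  simp only [Function.uncurry_def]
  fun_prop

theorem weightedMoment_zero_right {a : ℝ} (ha : 0 < a) (j k : ℕ) :
    weightedMoment a (j + 2) k 0 =
      (a⁻¹ ^ (j + 1) - (1 + a)⁻¹ ^ (j + 1)) / ((j : ℝ) + 1) := by
  have hc := continuous_inv_max ha
  have hj : (j : ℝ) + 1 ≠ 0 := by positivity
  unfold weightedMoment
  rw [integral_eq_sub_of_hasDerivAt (f := fun t => -(t⁻¹ ^ (j + 1)) / ((j : ℝ) + 1))]
  · ring
  · intro x hx
    rw [uIcc_of_le (by linarith)] at hx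
    have hx0 : x ≠ 0 := (ha.trans_le hx.1).ne'
    refine ((((hasDerivAt_inv hx0).pow (j + 1)).neg).div_const ((j : ℝ) + 1)).congr_deriv ?_
    rw [max_eq_left hx.1]
    push_cast
    simp only [inv_pow]
    field_simp
    rw [zero_mul, zero_add, one_pow]
    ring
  · exact Continuous.intervalIntegrable (by fun_prop) _ _

theorem weightedMoment_zero_zero (a : ℝ) (k : ℕ) : weightedMoment a 0 k 0 = 1 := by
  simp [weightedMoment]

/-- A function with `q a = q b = 0` whose derivative has the sign of `s` is positive inside
`(a, b)` if `s b < 0` and `s'` changes sign at most once, from negative to positive. -/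
theorem pos_of_deriv_sign_change {a b : ℝ} {q s w v φ : ℝ → ℝ}
    (hq : ∀ x ∈ Icc a b, HasDerivAt q (w x * s x) x)
    (hs : ∀ x ∈ Icc a b, HasDerivAt s (v x * φ x) x)
    (hw : ∀ x ∈ Icc a b, 0 < w x) (hv : ∀ x ∈ Icc a b, 0 < v x)
    (hφ : ∀ x ∈ Icc a b, ∀ y ∈ Icc a b, x < y → 0 ≤ φ x → 0 ≤ φ y)
    (hsb : s b < 0) (hqa : q a = 0) (hqb : q b = 0) {x : ℝ} (hax : a < x) (hxb : x < b) :
    0 < q x := by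
  have mvt : ∀ {F F' : ℝ → ℝ}, (∀ x ∈ Icc a b, HasDerivAt F (F' x) x) →
      ∀ u v, a ≤ u → u < v → v ≤ b → ∃ z ∈ Ioo u v, F v - F u = F' z * (v - u) := by
    intro F F' hF u v hu huv hv
    obtain ⟨z, hz, h⟩ := exists_hasDerivAt_eq_slope F F' huv
      (fun y hy => (hF y ⟨hu.trans hy.1, hy.2.trans hv⟩).continuousAt.continuousWithinAt)
      (fun y hy => hF y ⟨hu.trans hy.1.le, hy.2.le.trans hv⟩)
    refine ⟨z, hz, ?_⟩
    rw [h, div_mul_cancel₀ _ (sub_pos.2 huv).ne']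
  by_contra! hqx
  obtain ⟨y, hy, hy'⟩ := mvt hq a x le_rfl hax hxb.le
  obtain ⟨z, hz, hz'⟩ := mvt hq x b hax.le hxb le_rfl
  have hyI : y ∈ Icc a b := ⟨hy.1.le, hy.2.le.trans hxb.le⟩
  have hzI : z ∈ Icc a b := ⟨hax.le.trans hz.1.le, hz.2.le⟩
  have hsy : s y ≤ 0 := by
    by_contra! h
    have := mul_pos (mul_pos (hw y hyI) h) (sub_pos.2 hax)
    linarith
  have hsz : 0 ≤ s z := by
    by_contra! h
    have := mul_neg_of_neg_of_pos (mul_neg_of_pos_of_neg (hw z hzI) h) (sub_pos.2 hxb)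
    linarith
  have hyz : y < z := hy.2.trans hz.1
  obtain ⟨u, hu, hu'⟩ := mvt hs y z hyI.1 hyz hzI.2
  obtain ⟨t, ht, ht'⟩ := mvt hs z b hzI.1 hz.2 le_rfl
  have huI : u ∈ Icc a b := ⟨hyI.1.trans hu.1.le, hu.2.le.trans hzI.2⟩
  have htI : t ∈ Icc a b := ⟨hzI.1.trans ht.1.le, ht.2.le⟩
  have hφu : 0 ≤ φ u := by
    by_contra! h
    have := mul_neg_of_neg_of_pos (mul_neg_of_pos_of_neg (hv u huI) h) (sub_pos.2 hyz)
    linarith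
  have hφt := mul_nonneg (mul_nonneg (hv t htI).le
    (hφ u huI t htI (hu.2.trans ht.1) hφu)) (sub_pos.2 hz.2).le
  linarith

/-- The Euler operator `x² f'' - m x f' + m f` in divergence form. -/
theorem hasDerivAt_euler_flux {g g' : ℝ → ℝ} {g'' x : ℝ} (m : ℕ) (hx : x ≠ 0)
    (hg : HasDerivAt g (g' x) x) (hg' : HasDerivAt g' g'' x) :
    HasDerivAt (fun t => (t * g' t - g t) / t ^ m)
      ((x ^ 2 * g'' - m * x * g' x + m * g x) / x ^ (m + 1)) x := by
  refine ((((hasDerivAt_id x).mul hg').sub hg).div (hasDerivAt_pow m x)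
    (pow_ne_zero m hx)).congr_deriv ?_
  rcases m with _ | m
  · simp
    field_simp
  · simp only [id, Nat.add_sub_cancel, Pi.mul_apply, Pi.sub_apply]
    push_cast
    field_simp
    ring

/-- The homogeneous boundary value problem, with vanishing Cauchy data at both endpoints, has only
the trivial solution. -/
theorem homogeneous_bvp_trivial {a p c A B : ℝ} {m k : ℕ} (ha : 0 < a)
    (hc : |p| * (1 + 2 * a) < c) {g g' g'' : ℝ → ℝ}
    (hg : ∀ x, HasDerivAt g (g' x) x) (hg' : ∀ x, HasDerivAt g' (g'' x) x)
    (hode : ∀ x ∈ Icc a (1 + a), x ^ 2 * g'' x - m * x * g' x + m * g x =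
      -A * (p * (x - a) + c) ^ (k + 1) + B * x ^ 2 * (p * (x - a) + c) ^ k)
    (hga : g a = 0) (hgb : g (1 + a) = 0) (hga' : g' a = 0) (hgb' : g' (1 + a) = 0) :
    A = 0 ∧ B = 0 ∧ ∀ x ∈ Icc a (1 + a), g x = 0 := by
  have hab : a < 1 + a := by linarith
  have hP : ∀ x ∈ Icc a (1 + a), 0 < p * (x - a) + c := by
    intro x hx
    have h1 : |p * (x - a)| ≤ |p| * 1 := by
      rw [abs_mul, abs_of_nonneg (sub_nonneg.2 hx.1)]
      exact mul_le_mul_of_nonneg_left (by linarith [hx.2]) (abs_nonneg p)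
    nlinarith [neg_abs_le (p * (x - a)), mul_nonneg (abs_nonneg p) ha.le]
  have hpos : ∀ x ∈ Icc a (1 + a), x ≠ 0 := fun x hx => (ha.trans_le hx.1).ne'
  set s : ℝ → ℝ := fun t => (t * g' t - g t) / t ^ m with hsdef
  have hs : ∀ x ∈ Icc a (1 + a), HasDerivAt s
      ((-A * (p * (x - a) + c) ^ (k + 1) + B * x ^ 2 * (p * (x - a) + c) ^ k) / x ^ (m + 1)) x := by
    intro x hx
    rw [← hode x hx]
    exact hasDerivAt_euler_flux m (hpos x hx) (hg x) (hg' x)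
  have hq : ∀ x ∈ Icc a (1 + a),
      HasDerivAt (fun t => g t / t) ((g' x * x - g x) / x ^ 2) x := by
    intro x hx
    refine ((hg x).div (hasDerivAt_id x) (hpos x hx)).congr_deriv ?_
    simp
  have rolle : ∀ {F F' : ℝ → ℝ}, (∀ x ∈ Icc a (1 + a), HasDerivAt F (F' x) x) →
      ∀ u v, a ≤ u → u < v → v ≤ 1 + a → F u = 0 → F v = 0 → ∃ z ∈ Ioo u v, F' z = 0 := by
    intro F F' hF u v hu huv hv hFu hFv
    exact exists_hasDerivAt_eq_zero huv
      (fun y hy => (hF y ⟨hu.trans hy.1, hy.2.trans hv⟩).continuousAt.continuousWithinAt)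
      (hFu.trans hFv.symm) (fun y hy => hF y ⟨hu.trans hy.1.le, hy.2.le.trans hv⟩)
  obtain ⟨z, hz, hz'⟩ := rolle hq a (1 + a) le_rfl hab le_rfl (by simp [hga]) (by simp [hgb])
  have hzI : z ∈ Icc a (1 + a) := Ioo_subset_Icc_self hz
  have hsa : s a = 0 := by simp [hsdef, hga, hga']
  have hsb : s (1 + a) = 0 := by simp [hsdef, hgb, hgb']
  have hsz : s z = 0 := by
    have : g' z * z - g z = 0 := by
      simpa [hpos z hzI] using hz'
    simp [hsdef, mul_comm z, this]
  obtain ⟨x, hx, hx'⟩ := rolle hs a z le_rfl hz.1 hz.2.le hsa hsz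
  obtain ⟨y, hy, hy'⟩ := rolle hs z (1 + a) hz.1.le hz.2 le_rfl hsz hsb
  have hxI : x ∈ Icc a (1 + a) := ⟨hx.1.le, hx.2.le.trans hz.2.le⟩
  have hyI : y ∈ Icc a (1 + a) := ⟨hz.1.le.trans hy.1.le, hy.2.le⟩
  have key : ∀ x ∈ Icc a (1 + a),
      (-A * (p * (x - a) + c) ^ (k + 1) + B * x ^ 2 * (p * (x - a) + c) ^ k) / x ^ (m + 1) = 0 →
      B * x ^ 2 = A * (p * (x - a) + c) := by
    intro x hx h
    rw [div_eq_zero_iff, or_iff_left (pow_ne_zero _ (hpos x hx))] at h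
    have h2 : (p * (x - a) + c) ^ k * (B * x ^ 2 - A * (p * (x - a) + c)) = 0 := by
      rw [← h]; ring
    rcases mul_eq_zero.1 h2 with h3 | h3
    · exact absurd h3 (pow_pos (hP x hx) k).ne'
    · linarith
  have hxk := key x hxI hx'
  have hyk := key y hyI hy'
  have hxy : x < y := hx.2.trans hy.1
  have hx0 : 0 < x := ha.trans_le hxI.1
  have hy0 : 0 < y := ha.trans_le hyI.1
  have hdet : 0 < (x + y) * (c - p * a) + p * x * y := by
    have h1 : p * a ≤ |p| * a := mul_le_mul_of_nonneg_right (le_abs_self p) ha.le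
    have h2 : -(|p| * (x * y)) ≤ p * (x * y) := by
      nlinarith [neg_abs_le p, mul_pos hx0 hy0]
    have h3 : |p| * (x * y) ≤ |p| * (x * (1 + a)) :=
      mul_le_mul_of_nonneg_left (mul_le_mul_of_nonneg_left hyI.2 hx0.le) (abs_nonneg p)
    have h4 : 0 < (x + y) * (c - |p| * (1 + 2 * a)) := mul_pos (by linarith) (by linarith)
    have h5 : 0 ≤ |p| * (1 + a) * y := by positivity
    nlinarith
  have hA : A = 0 := by
    have : A * ((y - x) * ((x + y) * (c - p * a) + p * x * y)) = 0 := by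
      linear_combination (-y ^ 2) * hxk + x ^ 2 * hyk
    exact (mul_eq_zero.1 this).resolve_right (mul_pos (sub_pos.2 hxy) hdet).ne'
  have hB : B = 0 := by
    rw [hA, zero_mul] at hxk
    exact (mul_eq_zero.1 hxk).resolve_right (pow_pos hx0 2).ne'
  have const : ∀ {F F' : ℝ → ℝ}, (∀ x ∈ Icc a (1 + a), HasDerivAt F (F' x) x) →
      (∀ x ∈ Icc a (1 + a), F' x = 0) → ∀ x ∈ Icc a (1 + a), F x = F a := by
    intro F F' hF hF'
    refine constant_of_has_deriv_right_zero
      (fun y hy => (hF y hy).continuousAt.continuousWithinAt) fun y hy => ?_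
    have := hF y (Ico_subset_Icc_self hy)
    rw [hF' y (Ico_subset_Icc_self hy)] at this
    exact this.hasDerivWithinAt
  have hs0 := const hs (by intro x _; simp [hA, hB])
  refine ⟨hA, hB, fun x hx => ?_⟩
  have hq0 := const hq (fun x hx => by
    have h := hs0 x hx
    rw [hsa, hsdef] at h
    have h : x * g' x - g x = 0 := by
      simpa [hpos x hx] using h
    simp [mul_comm (g' x), h]) x hx
  simpa [hga, hpos x hx] using hq0

/-- A `C²` solution of the Euler equation with the first three boundary conditions, obtained by
two quadratures. -/
theorem exists_normalized_solution {a η A B s₀ : ℝ} (k : ℕ) (ha : 0 < a)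
    (hA : 0 < A) (hB : 0 < B) (hη : |η| * (1 + 2 * a) < 1)
    (hs₀ : s₀ = 2 * a⁻¹ ^ (2 * k + 3))
    (h₁ : -A * weightedMoment a (2 * k + 5) (k + 1) η + B * weightedMoment a (2 * k + 3) k η =
      -(2 * ((1 + a)⁻¹ ^ (2 * k + 3) * (η + 1) ^ (k + 1) + a⁻¹ ^ (2 * k + 3))))
    (h₂ : -A * weightedMoment a 2 (k + 1) η + B * weightedMoment a 0 k η =
      -(2 * ((η + 1) ^ (k + 1) + 1))) :
    ∃ f f' f'' : ℝ → ℝ, (∀ x, HasDerivAt f (f' x) x) ∧ (∀ x, HasDerivAt f' (f'' x) x) ∧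
      Continuous f'' ∧
      (∀ x ∈ Icc a (1 + a), x ^ 2 * f'' x - (2 * k + 4 : ℝ) * x * f' x + (2 * k + 4 : ℝ) * f x =
        -A * (η * (x - a) + 1) ^ (k + 1) + B * x ^ 2 * (η * (x - a) + 1) ^ k) ∧
      f a = 0 ∧ f (1 + a) = 0 ∧ f' a = 2 ∧ f' (1 + a) = -2 * (η + 1) ^ (k + 1) ∧
      ∀ x, a < x → x < 1 + a → 0 < f x := by
  have hab : a < 1 + a := by linarith
  have hb : 0 < 1 + a := by linarith
  have hW := continuous_inv_max ha
  set W : ℝ → ℝ := fun t => (max t a)⁻¹ with hWdef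
  have hWx : ∀ x ∈ Icc a (1 + a), W x = x⁻¹ := fun x hx => by
    simp only [hWdef, max_eq_left hx.1]
  have hpos : ∀ x ∈ Icc a (1 + a), 0 < x := fun x hx => ha.trans_le hx.1
  set r : ℝ → ℝ := fun t => -A * (W t ^ (2 * k + 5) * (η * (t - a) + 1) ^ (k + 1)) +
    B * (W t ^ (2 * k + 3) * (η * (t - a) + 1) ^ k) with hrdef
  have hr : Continuous r := by fun_prop
  have hrx : ∀ x ∈ Icc a (1 + a), x ^ (2 * k + 5) * r x =
      -A * (η * (x - a) + 1) ^ (k + 1) + B * x ^ 2 * (η * (x - a) + 1) ^ k := by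
    intro x hx
    have := (hpos x hx).ne'
    simp only [hrdef, hWx x hx, inv_pow]
    field_simp
    ring
  set s : ℝ → ℝ := fun x => s₀ + ∫ t in a..x, r t with hsdef
  have hs : ∀ x, HasDerivAt s (r x) x := fun x =>
    (integral_hasDerivAt_right (hr.intervalIntegrable _ _)
      (hr.stronglyMeasurableAtFilter _ _) hr.continuousAt).const_add s₀
  have hsc : Continuous s := continuous_iff_continuousAt.2 fun x => (hs x).continuousAt
  have hqc : Continuous fun t : ℝ => t ^ (2 * k + 2) * s t := by fun_prop
  set q : ℝ → ℝ := fun x => ∫ t in a..x, t ^ (2 * k + 2) * s t with hqdef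
  have hq : ∀ x, HasDerivAt q (x ^ (2 * k + 2) * s x) x := fun x =>
    integral_hasDerivAt_right (hqc.intervalIntegrable _ _)
      (hqc.stronglyMeasurableAtFilter _ _) hqc.continuousAt
  have hqa : q a = 0 := by simp [hqdef]
  have hsa : s a = s₀ := by simp [hsdef]
  have hsb : s (1 + a) = -(2 * ((1 + a)⁻¹ ^ (2 * k + 3) * (η + 1) ^ (k + 1))) := by
    have : ∫ t in a..(1 + a), r t = -A * weightedMoment a (2 * k + 5) (k + 1) η +
        B * weightedMoment a (2 * k + 3) k η := by
      simp only [hrdef, weightedMoment]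
      rw [integral_add, integral_const_mul, integral_const_mul]
      · exact Continuous.intervalIntegrable (by fun_prop) _ _
      · exact Continuous.intervalIntegrable (by fun_prop) _ _
    simp only [hsdef]
    rw [this, h₁, hs₀]
    ring
  have hqb : q (1 + a) = 0 := by
    have hparts := integral_mul_deriv_eq_deriv_mul (a := a) (b := 1 + a)
      (u := s) (u' := r) (v := fun t => t ^ (2 * k + 3))
      (v' := fun t => ((2 * k + 3 : ℕ) : ℝ) * t ^ (2 * k + 2))
      (fun x _ => hs x) (fun x _ => by simpa using hasDerivAt_pow (2 * k + 3) x)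
      (hr.intervalIntegrable _ _) (Continuous.intervalIntegrable (by fun_prop) _ _)
    have hleft : ∫ t in a..(1 + a), s t * (((2 * k + 3 : ℕ) : ℝ) * t ^ (2 * k + 2)) =
        ((2 * k + 3 : ℕ) : ℝ) * q (1 + a) := by
      simp only [hqdef]
      rw [← integral_const_mul]
      congr 1
      ext t
      ring
    have hright : ∫ t in a..(1 + a), r t * t ^ (2 * k + 3) =
        -A * weightedMoment a 2 (k + 1) η + B * weightedMoment a 0 k η := by
      simp only [weightedMoment]
      change _ = -A * (∫ t in a..(1 + a), W t ^ 2 * (η * (t - a) + 1) ^ (k + 1)) +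
        B * ∫ t in a..(1 + a), W t ^ 0 * (η * (t - a) + 1) ^ k
      rw [← integral_const_mul, ← integral_const_mul, ← integral_add]
      · apply integral_congr
        intro x hx
        rw [uIcc_of_le hab.le] at hx
        have hx0 := (hpos x hx).ne'
        simp only [hrdef, hWx x hx, inv_pow]
        field_simp
        ring
      · exact Continuous.intervalIntegrable (by fun_prop) _ _
      · exact Continuous.intervalIntegrable (by fun_prop) _ _
    rw [hleft, hright, h₂, hsb, hsa, hs₀] at hparts
    have : ((2 * k + 3 : ℕ) : ℝ) * q (1 + a) = 0 := by
      rw [hparts]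
      simp only [inv_pow]
      field_simp
      ring
    exact (mul_eq_zero.1 this).resolve_left (by positivity)
  have hP : ∀ x ∈ Icc a (1 + a), 0 < η * (x - a) + 1 := by
    intro x hx
    have h1 : |η * (x - a)| ≤ |η| * 1 := by
      rw [abs_mul, abs_of_nonneg (sub_nonneg.2 hx.1)]
      exact mul_le_mul_of_nonneg_left (by linarith [hx.2]) (abs_nonneg η)
    nlinarith [neg_abs_le (η * (x - a)), mul_nonneg (abs_nonneg η) ha.le]
  have hηb : 0 < η + 1 := by simpa using hP (1 + a) ⟨hab.le, le_rfl⟩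
  have hηa : 0 < 1 - η * a := by
    nlinarith [mul_le_mul_of_nonneg_right (le_abs_self η) ha.le, abs_nonneg η,
      mul_nonneg (abs_nonneg η) ha.le]
  have hqpos : ∀ x, a < x → x < 1 + a → 0 < q x := by
    intro x hx hx'
    refine pos_of_deriv_sign_change (w := fun x => x ^ (2 * k + 2)) (s := s)
      (v := fun x => (x ^ (2 * k + 5))⁻¹ * (η * (x - a) + 1) ^ k)
      (φ := fun x => -A * (η * (x - a) + 1) + B * x ^ 2)
      (fun x _ => hq x) (fun x hx => (hs x).congr_deriv ?_)
      (fun x hx => pow_pos (hpos x hx) _)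
      (fun x hx => mul_pos (inv_pos.2 (pow_pos (hpos x hx) _)) (pow_pos (hP x hx) _))
      ?_ ?_ hqa hqb hx hx'
    · have hx0 : x ^ (2 * k + 5) ≠ 0 := (pow_pos (hpos x hx) _).ne'
      rw [mul_assoc, eq_inv_mul_iff_mul_eq₀ hx0, hrx x hx]
      ring
    · intro x hx y hy hxy h
      have hx0 := hpos x hx
      have hy0 := hpos y hy
      have h3 : x * (-A * (η * (y - a) + 1) + B * y ^ 2) =
          y * (-A * (η * (x - a) + 1) + B * x ^ 2) +
            (y - x) * (A * (1 - η * a) + B * (x * y)) := by ring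
      have h4 : 0 ≤ x * (-A * (η * (y - a) + 1) + B * y ^ 2) := by
        rw [h3]
        have := sub_pos.2 hxy
        positivity
      exact nonneg_of_mul_nonneg_right h4 hx0
    · rw [hsb]
      have : 0 < (1 + a)⁻¹ ^ (2 * k + 3) * (η + 1) ^ (k + 1) := by positivity
      linarith
  refine ⟨fun x => x * q x, fun x => q x + x ^ (2 * k + 3) * s x,
    fun x => (2 * k + 4 : ℝ) * x ^ (2 * k + 2) * s x + x ^ (2 * k + 3) * r x,
    fun x => ?_, fun x => ?_, by fun_prop, fun x hx => ?_, by simp [hqa], by simp [hqb], ?_, ?_,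
    fun x hx hx' => mul_pos (ha.trans hx) (hqpos x hx hx')⟩
  · refine ((hasDerivAt_id x).mul (hq x)).congr_deriv ?_
    rw [id_eq]
    ring
  · refine ((hq x).add ((hasDerivAt_pow (2 * k + 3) x).mul (hs x))).congr_deriv ?_
    rw [show 2 * k + 3 - 1 = 2 * k + 2 by omega]
    push_cast
    ring
  · rw [← hrx x hx]
    ring
  · simp only [hqa, hsa, hs₀, inv_pow]
    field_simp
    ring
  · simp only [hqb, hsb, inv_pow]
    field_simp
    ring

theorem eventually_exists_normalized_solution {a : ℝ} (k : ℕ) (ha : 0 < a) :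
    ∀ᶠ η in 𝓝 (0 : ℝ), ∃ A B : ℝ, 0 < A ∧ 0 < B ∧
      ∃ f f' f'' : ℝ → ℝ, (∀ x, HasDerivAt f (f' x) x) ∧ (∀ x, HasDerivAt f' (f'' x) x) ∧
      Continuous f'' ∧
      (∀ x ∈ Icc a (1 + a), x ^ 2 * f'' x - (2 * k + 4 : ℝ) * x * f' x + (2 * k + 4 : ℝ) * f x =
        -A * (η * (x - a) + 1) ^ (k + 1) + B * x ^ 2 * (η * (x - a) + 1) ^ k) ∧
      f a = 0 ∧ f (1 + a) = 0 ∧ f' a = 2 ∧ f' (1 + a) = -2 * (η + 1) ^ (k + 1) ∧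
      ∀ x, a < x → x < 1 + a → 0 < f x := by
  set α₁ := weightedMoment a (2 * k + 5) (k + 1) with hα₁
  set β₁ := weightedMoment a (2 * k + 3) k with hβ₁
  set α₂ := weightedMoment a 2 (k + 1) with hα₂
  set β₂ := weightedMoment a 0 k with hβ₂
  set γ₁ : ℝ → ℝ := fun η =>
    2 * ((1 + a)⁻¹ ^ (2 * k + 3) * (η + 1) ^ (k + 1) + a⁻¹ ^ (2 * k + 3)) with hγ₁
  set γ₂ : ℝ → ℝ := fun η => 2 * ((η + 1) ^ (k + 1) + 1) with hγ₂
  have cα₁ : Continuous α₁ := continuous_weightedMoment ha _ _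
  have cβ₁ : Continuous β₁ := continuous_weightedMoment ha _ _
  have cα₂ : Continuous α₂ := continuous_weightedMoment ha _ _
  have cβ₂ : Continuous β₂ := continuous_weightedMoment ha _ _
  have cγ₁ : Continuous γ₁ := by fun_prop
  have cγ₂ : Continuous γ₂ := by fun_prop
  set X := a⁻¹ with hX
  set Y := (1 + a)⁻¹ with hY
  have hY0 : 0 < Y := by positivity
  have hXY : X - Y = X * Y := by
    have : 1 + a ≠ 0 := by positivity
    rw [hX, hY]
    field_simp
    ring
  have hX0 : 0 < X := by positivity
  have hlt : Y < X := by nlinarith [mul_pos hX0 hY0]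
  set E := X ^ (2 * k + 3) + Y ^ (2 * k + 3) with hE
  set T := X ^ (2 * k + 2) - Y ^ (2 * k + 2) with hT
  have hET : 2 * T < (2 * k + 2) * E := by
    have := trapezoid_pow_lt hY0 hlt (j := 2 * k + 2) (by omega)
    rw [hXY] at this
    push_cast at this
    have h : 0 < X * Y * ((2 * k + 2) * E - 2 * T) := by
      rw [hE, hT]; linarith
    have := pos_of_mul_pos_right h (mul_pos hX0 hY0).le
    linarith
  have vα₁ : α₁ 0 = X * Y * (E + T) / (2 * k + 4) := by
    rw [hα₁, weightedMoment_zero_right ha]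
    have : X * Y * (E + T) = X ^ (2 * k + 3 + 1) - Y ^ (2 * k + 3 + 1) := by
      rw [mul_add, ← hXY, hE, mul_comm (X - Y) T, mul_comm, hXY, hT]
      linear_combination (-(X ^ (2 * k + 3) + Y ^ (2 * k + 3))) * hXY
    rw [this]
    push_cast
    ring
  have vβ₁ : β₁ 0 = T / (2 * k + 2) := by
    rw [hβ₁, weightedMoment_zero_right ha, hT]
    push_cast
    ring
  have vα₂ : α₂ 0 = X * Y := by
    rw [hα₂, weightedMoment_zero_right ha, ← hXY]
    simp [hX, hY]
  have vβ₂ : β₂ 0 = 1 := weightedMoment_zero_zero a k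
  have vγ₁ : γ₁ 0 = 2 * E := by simp [hγ₁, hE, add_comm]
  have vγ₂ : γ₂ 0 = 4 := by norm_num [hγ₂]
  have hdet : 0 < α₁ 0 * β₂ 0 - α₂ 0 * β₁ 0 := by
    rw [vα₁, vβ₁, vα₂, vβ₂]
    have : X * Y * (E + T) / (2 * k + 4) * 1 - X * Y * (T / (2 * k + 2)) =
        X * Y * ((2 * k + 2) * E - 2 * T) / ((2 * k + 4) * (2 * k + 2)) := by
      field_simp
      ring
    rw [this]
    exact div_pos (mul_pos (mul_pos hX0 hY0) (by linarith)) (by positivity)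
  have hA : 0 < γ₁ 0 * β₂ 0 - γ₂ 0 * β₁ 0 := by
    rw [vγ₁, vβ₁, vγ₂, vβ₂]
    have : 2 * E * 1 - 4 * (T / (2 * k + 2)) =
        2 * ((2 * k + 2) * E - 2 * T) / (2 * k + 2) := by
      field_simp
      ring
    rw [this]
    exact div_pos (by linarith) (by positivity)
  have hB : 0 < γ₁ 0 * α₂ 0 - γ₂ 0 * α₁ 0 := by
    rw [vγ₁, vα₁, vγ₂, vα₂]
    have : 2 * E * (X * Y) - 4 * (X * Y * (E + T) / (2 * k + 4)) =
        2 * (X * Y) * ((2 * k + 2) * E - 2 * T) / (2 * k + 4) := by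
      field_simp
      ring
    rw [this]
    exact div_pos (mul_pos (mul_pos two_pos (mul_pos hX0 hY0)) (by linarith)) (by positivity)
  have eventually_pos : ∀ {h : ℝ → ℝ}, Continuous h → 0 < h 0 → ∀ᶠ η in 𝓝 0, 0 < h η :=
    fun hc h0 => hc.continuousAt.eventually (lt_mem_nhds h0)
  have hsmall : ∀ᶠ η in 𝓝 (0 : ℝ), 0 < 1 - |η| * (1 + 2 * a) :=
    eventually_pos (by fun_prop) (by simp)
  filter_upwards [eventually_pos (h := fun η => α₁ η * β₂ η - α₂ η * β₁ η) (by fun_prop) hdet,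
    eventually_pos (h := fun η => γ₁ η * β₂ η - γ₂ η * β₁ η) (by fun_prop) hA,
    eventually_pos (h := fun η => γ₁ η * α₂ η - γ₂ η * α₁ η) (by fun_prop) hB, hsmall] with η hdet hA hB hη
  refine ⟨_, _, div_pos hA hdet, div_pos hB hdet,
    exists_normalized_solution k ha (div_pos hA hdet) (div_pos hB hdet) (by linarith) rfl ?_ ?_⟩
  · change _ * α₁ η + _ * β₁ η = -γ₁ η
    rw [← neg_div, div_mul_eq_mul_div, div_mul_eq_mul_div, ← add_div, div_eq_iff hdet.ne']
    ring
  · change _ * α₂ η + _ * β₂ η = -γ₂ η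
    rw [← neg_div, div_mul_eq_mul_div, div_mul_eq_mul_div, ← add_div, div_eq_iff hdet.ne']
    ring

/-- Existence and uniqueness for the boundary value problem arising in the construction of
conformally constant Hermitian scalar curvature metrics on ruled manifolds:
for `c` sufficiently large there exist unique `A > 0`, `B > 0` and
`f ∈ C²` near `[λ, 1+λ]` with
`x² f'' - m x f' + m f = -A·P(x-λ)^(n-1) + B·x²·P(x-λ)^(n-2)` (`P(x-λ) = p(x-λ)+c`, `m = 2n`),
`f(λ) = f(1+λ) = 0`, `f'(λ) = 2c^(n-1)`, `f'(1+λ) = -2(p+c)^(n-1)`,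
and moreover `f > 0` on the open interval `(λ, 1+λ)`. -/
theorem ruled_bvp_existence_uniqueness
    (n : ℕ) (hn : 2 ≤ n) (lam p : ℝ) (hlam : 0 < lam) :
    ∃ c₀ : ℝ, ∀ c ≥ c₀,
      (∃ A B : ℝ, ∃ f : ℝ → ℝ, 0 < A ∧ 0 < B ∧
        (∃ a b : ℝ, a < lam ∧ 1 + lam < b ∧ ContDiffOn ℝ 2 f (Set.Ioo a b)) ∧
        (∀ x ∈ Set.Icc lam (1 + lam),
          x ^ 2 * deriv (deriv f) x - (2 * n : ℝ) * x * deriv f x + (2 * n : ℝ) * f x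
            = -A * (p * (x - lam) + c) ^ (n - 1) + B * x ^ 2 * (p * (x - lam) + c) ^ (n - 2)) ∧
        f lam = 0 ∧ f (1 + lam) = 0 ∧
        deriv f lam = 2 * c ^ (n - 1) ∧ deriv f (1 + lam) = -2 * (p + c) ^ (n - 1) ∧
        (∀ x : ℝ, lam < x → x < 1 + lam → 0 < f x)) ∧
      (∀ A₁ B₁ : ℝ, ∀ f₁ : ℝ → ℝ, ∀ A₂ B₂ : ℝ, ∀ f₂ : ℝ → ℝ,
        Differentiable ℝ f₁ → Differentiable ℝ (deriv f₁) →
        Differentiable ℝ f₂ → Differentiable ℝ (deriv f₂) →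
        (∀ x ∈ Set.Icc lam (1 + lam),
          x ^ 2 * deriv (deriv f₁) x - (2 * n : ℝ) * x * deriv f₁ x + (2 * n : ℝ) * f₁ x
            = -A₁ * (p * (x - lam) + c) ^ (n - 1) + B₁ * x ^ 2 * (p * (x - lam) + c) ^ (n - 2)) →
        (∀ x ∈ Set.Icc lam (1 + lam),
          x ^ 2 * deriv (deriv f₂) x - (2 * n : ℝ) * x * deriv f₂ x + (2 * n : ℝ) * f₂ x
            = -A₂ * (p * (x - lam) + c) ^ (n - 1) + B₂ * x ^ 2 * (p * (x - lam) + c) ^ (n - 2)) →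
        f₁ lam = 0 → f₁ (1 + lam) = 0 →
        deriv f₁ lam = 2 * c ^ (n - 1) → deriv f₁ (1 + lam) = -2 * (p + c) ^ (n - 1) →
        f₂ lam = 0 → f₂ (1 + lam) = 0 →
        deriv f₂ lam = 2 * c ^ (n - 1) → deriv f₂ (1 + lam) = -2 * (p + c) ^ (n - 1) →
        A₁ = A₂ ∧ B₁ = B₂ ∧ ∀ x ∈ Set.Icc lam (1 + lam), f₁ x = f₂ x) := by
  obtain ⟨k, rfl⟩ : ∃ k, n = k + 2 := ⟨n - 2, by omega⟩
  have h₁ : k + 2 - 1 = k + 1 := by omega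
  have h₂ : k + 2 - 2 = k := by omega
  have hm : (2 * ((k + 2 : ℕ) : ℝ)) = 2 * k + 4 := by push_cast; ring
  rw [h₁, h₂, hm]
  have hlim : Tendsto (fun c : ℝ => p / c) atTop (𝓝 0) := tendsto_const_nhds.div_atTop tendsto_id
  refine eventually_atTop.1 ?_
  filter_upwards [hlim.eventually (eventually_exists_normalized_solution k hlam),
    eventually_gt_atTop 0, eventually_gt_atTop (|p| * (1 + 2 * lam))] with c hex hc hcp
  constructor
  · obtain ⟨A, B, hA, hB, f, f', f'', hf, hf', hf'', hode, hfa, hfb, hfa', hfb', hpos⟩ := hex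
    have hscale : ∀ x, c * (p / c * (x - lam) + 1) = p * (x - lam) + c := fun x => by
      field_simp
    have hd : deriv (fun x => c ^ (k + 1) * f x) = fun x => c ^ (k + 1) * f' x :=
      funext fun x => ((hf x).const_mul _).deriv
    have hd' : deriv (fun x => c ^ (k + 1) * f' x) = fun x => c ^ (k + 1) * f'' x :=
      funext fun x => ((hf' x).const_mul _).deriv
    refine ⟨A, c * B, fun x => c ^ (k + 1) * f x, hA, mul_pos hc hB,
      ⟨lam - 1, lam + 2, by linarith, by linarith, ContDiff.contDiffOn ?_⟩, fun x hx => ?_,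
      by simp [hfa], by simp [hfb], ?_, ?_,
      fun x hx hx' => mul_pos (pow_pos hc _) (hpos x hx hx')⟩
    · rw [show (2 : WithTop ℕ∞) = 1 + 1 by norm_num, contDiff_succ_iff_deriv, hd,
        contDiff_one_iff_deriv, hd']
      exact ⟨fun x => ((hf x).const_mul _).differentiableAt, by simp,
        fun x => ((hf' x).const_mul _).differentiableAt, by fun_prop⟩
    · rw [hd, hd', ← hscale x, mul_pow, mul_pow]
      linear_combination c ^ (k + 1) * hode x hx
    · rw [hd]
      simp only [hfa']
      ring
    · rw [hd]
      simp only [hfb']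
      rw [show p + c = c * (p / c + 1) by field_simp, mul_pow]
      ring
  · intro A₁ B₁ f₁ A₂ B₂ f₂ hf₁ hf₁' hf₂ hf₂' hode₁ hode₂ ha₁ hb₁ ha₁' hb₁' ha₂ hb₂ ha₂' hb₂'
    obtain ⟨hA, hB, hf⟩ := homogeneous_bvp_trivial (m := 2 * k + 4) (k := k) (A := A₁ - A₂)
      (B := B₁ - B₂) hlam hcp (g := fun x => f₁ x - f₂ x)
      (fun x => (hf₁ x).hasDerivAt.sub (hf₂ x).hasDerivAt)
      (fun x => (hf₁' x).hasDerivAt.sub (hf₂' x).hasDerivAt)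
      (fun x hx => by push_cast; linear_combination hode₁ x hx - hode₂ x hx)
      (by simp [ha₁, ha₂]) (by simp [hb₁, hb₂]) (by simp [ha₁', ha₂']) (by simp [hb₁', hb₂'])
    exact ⟨sub_eq_zero.1 hA, sub_eq_zero.1 hB, fun x hx => sub_eq_zero.1 (hf x hx)⟩
end
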